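/- arXiv:1707.01146 — 3 statements merged into one kernel-verified Lean document; each statement's English description precedes it below -/
import Mathlib

section
/- Let f : ℝⁿ × ℝ^q → ℝⁿ, let λ ∈ ℝ, and let φ : ℝⁿ × ℝ^q → ℝ be differentiable and satisfy, for every fixed input value ū ∈ ℝ^q, the parameterized eigenfunction equation ∇ₓφ(x, ū) ⋅ f(x, ū) = λ φ(x, ū) for all x ∈ ℝⁿ. Then for all differentiable curves x : ℝ → ℝⁿ and u : ℝ → ℝ^q with x'(t) = f(x(t), u(t)) for all t, one has (d/dt) φ(x(t), u(t)) = λ φ(x(t), u(t)) + ∇ᵤφ(x(t), u(t)) ⋅ u'(t) for all t, where ∇ₓ and ∇ᵤ denote the partial gradients with respect to the state and input arguments respectively. -/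
/-- For a nonaffine control system `dx/dt = f (x, u)`, suppose `φ (·, ū)` is a Koopman
eigenfunction with eigenvalue `lam` for each locked input value `ū`.  Then along
trajectories with time-varying input `u(t)`,
`(d/dt) φ(x(t), u(t)) = lam * φ(x(t), u(t)) + ∇ᵤφ(x(t), u(t)) ⋅ u'(t)`. -/
theorem koopman_eigenfunction_nonaffine_control {n q : ℕ}
    (f : (Fin n → ℝ) × (Fin q → ℝ) → (Fin n → ℝ)) (lam : ℝ)
    (φ : (Fin n → ℝ) × (Fin q → ℝ) → ℝ) (hφ : Differentiable ℝ φ)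
    (heig : ∀ (ub : Fin q → ℝ) (x : Fin n → ℝ),
      fderiv ℝ φ (x, ub) (f (x, ub), 0) = lam * φ (x, ub))
    (x : ℝ → (Fin n → ℝ)) (hx : Differentiable ℝ x)
    (u : ℝ → (Fin q → ℝ)) (hu : Differentiable ℝ u)
    (hode : ∀ t, deriv x t = f (x t, u t)) :
    ∀ t, deriv (fun s => φ (x s, u s)) t
      = lam * φ (x t, u t) + fderiv ℝ φ (x t, u t) (0, deriv u t) := by
  intro t
  have hchain : HasDerivAt (fun s => φ (x s, u s))
      (fderiv ℝ φ (x t, u t) (deriv x t, deriv u t)) t :=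
    (hφ (x t, u t)).hasFDerivAt.comp_hasDerivAt t
      ((hx t).hasDerivAt.prodMk (hu t).hasDerivAt)
  have hsplit : (deriv x t, deriv u t) = (f (x t, u t), 0) + (0, deriv u t) := by
    simp [hode]
  rw [hchain.deriv, hsplit, map_add, heig]
end

section
/- Let H : ℝⁿ → ℝ be differentiable, f : ℝⁿ → ℝⁿ with ∇H(x) ⋅ f(x) = 0 for all x, B ∈ ℝⁿ a constant vector (single-channel input), and Q, R > 0. Consider the feedback law u(x) = − sign(∇H(x) ⋅ B) √(Q/R) H(x) (with sign(0) = 0). Then along every differentiable solution x(t) of the closed-loop system x'(t) = f(x(t)) + B u(x(t)) one has (d/dt) H(x(t)) = − |∇H(x(t)) ⋅ B| √(Q/R) H(x(t)); in particular, the function t ↦ H(x(t))² is nonincreasing. -/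
theorem Real.sign_mul_self_eq_abs (r : ℝ) : Real.sign r * r = |r| := by
  rcases lt_trichotomy r 0 with h | rfl | h
  · rw [Real.sign_of_neg h, abs_of_neg h, neg_one_mul]
  · simp
  · rw [Real.sign_of_pos h, abs_of_pos h, one_mul]

/-- KRONIC energy feedback: with the control law
`u(x) = − sign(∇H(x) ⋅ B) √(Q/R) H(x)` applied to the single-input control-affine system
`dx/dt = f x + B u` whose drift conserves `H`, one gets
`(d/dt) H(x(t)) = − |∇H(x(t)) ⋅ B| √(Q/R) H(x(t))`; in particular `t ↦ H(x(t))²` is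
nonincreasing. -/
theorem kronic_energy_feedback {n : ℕ}
    (H : (Fin n → ℝ) → ℝ) (hH : Differentiable ℝ H)
    (f : (Fin n → ℝ) → (Fin n → ℝ))
    (hcons : ∀ x, fderiv ℝ H x (f x) = 0)
    (B : Fin n → ℝ) (Q R : ℝ) (hQ : 0 < Q) (hR : 0 < R)
    (x : ℝ → (Fin n → ℝ)) (hx : Differentiable ℝ x)
    (hode : ∀ t, deriv x t = f (x t)
      + (-(Real.sign (fderiv ℝ H (x t) B)) * Real.sqrt (Q / R) * H (x t)) • B) :
    (∀ t, deriv (fun s => H (x s)) t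
        = -|fderiv ℝ H (x t) B| * Real.sqrt (Q / R) * H (x t)) ∧
      Antitone (fun t => (H (x t)) ^ 2) := by
  have hderiv : ∀ t, HasDerivAt (fun s => H (x s))
      (-|fderiv ℝ H (x t) B| * Real.sqrt (Q / R) * H (x t)) t := by
    intro t
    have h := (hH (x t)).hasFDerivAt.comp_hasDerivAt t (hx t).hasDerivAt
    rw [hode t, map_add, hcons, map_smul, zero_add, smul_eq_mul] at h
    refine h.congr_deriv ?_
    rw [← Real.sign_mul_self_eq_abs]
    ring
  refine ⟨fun t => (hderiv t).deriv, ?_⟩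
  refine antitone_of_hasDerivAt_nonpos (fun t => (hderiv t).pow 2) fun t => ?_
  have h : 0 ≤ |fderiv ℝ H (x t) B| * Real.sqrt (Q / R) * (H (x t)) ^ 2 := by positivity
  norm_num
  linarith
end

section
/- Let B ≠ 0 and Q, R > 0 be real numbers, and set P = √(Q R)/|B|. Let h : [0, ∞) → ℝ be differentiable and u : [0, ∞) → ℝ be continuous with h'(t) = B u(t) for all t ≥ 0, suppose h(t) → 0 as t → ∞, and suppose the function t ↦ Q h(t)² + R u(t)² is integrable on [0, ∞). Then ∫₀^∞ (Q h(t)² + R u(t)²) dt ≥ P h(0)². Moreover, if u(t) = − sign(B) √(Q/R) h(t) for all t ≥ 0, then h(t) = h(0) e^{−|B| √(Q/R) t} and the integral equals exactly P h(0)². -/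
open MeasureTheory

/-- A solution of `dh/dt = -k h` on `[0, ∞)` is `h(t) = h(0) e^{-k t}`. -/
theorem eq_mul_exp_of_hasDerivAt {h : ℝ → ℝ} {k : ℝ}
    (hode : ∀ t ≥ (0 : ℝ), HasDerivAt h (-k * h t) t) {t : ℝ} (ht : 0 ≤ t) :
    h t = h 0 * Real.exp (-k * t) := by
  have hderiv : ∀ x ≥ (0 : ℝ), HasDerivAt (fun y => h y * Real.exp (k * y)) 0 x := by
    intro x hx
    have hexp : HasDerivAt (fun y => Real.exp (k * y)) (Real.exp (k * x) * (k * 1)) x :=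
      ((hasDerivAt_id x).const_mul k).exp
    refine ((hode x hx).mul hexp).congr_deriv ?_
    ring
  have hconst : h t * Real.exp (k * t) = h 0 * Real.exp (k * 0) :=
    constant_of_has_deriv_right_zero
      (fun x hx => (hderiv x hx.1).continuousAt.continuousWithinAt)
      (fun x hx => (hderiv x hx.1).hasDerivWithinAt) t ⟨ht, le_rfl⟩
  rw [mul_zero, Real.exp_zero, mul_one] at hconst
  rw [← hconst, mul_assoc, ← Real.exp_add, neg_mul, add_neg_cancel, Real.exp_zero, mul_one]

/-- The integral of the derivative of the value function `P h²` along an admissible trajectory,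
where the feedback gain `c` satisfies the Riccati relations `R c² = Q` and `P B = R c`. -/
theorem integral_deriv_value {B Q R P c : ℝ} (hR : 0 < R) (hc : R * c ^ 2 = Q)
    (hPB : P * B = R * c) {h u : ℝ → ℝ} (hu : Continuous u)
    (hode : ∀ t ≥ (0 : ℝ), HasDerivAt h (B * u t) t)
    (hlim : Filter.Tendsto h Filter.atTop (nhds 0))
    (hint : IntegrableOn (fun t => Q * h t ^ 2 + R * u t ^ 2) (Set.Ici 0)) :
    IntegrableOn (fun t => 2 * (R * c) * (h t * u t)) (Set.Ici 0) ∧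
      ∫ t in Set.Ici (0 : ℝ), 2 * (R * c) * (h t * u t) = -(P * h 0 ^ 2) := by
  have hcont : ContinuousOn h (Set.Ici 0) :=
    fun t ht => (hode t ht).continuousAt.continuousWithinAt
  have hI : IntegrableOn (fun t => 2 * (R * c) * (h t * u t)) (Set.Ici 0) := by
    refine Integrable.mono' hint
      ((continuousOn_const.mul (hcont.mul hu.continuousOn)).aestronglyMeasurable
        measurableSet_Ici) (Filter.Eventually.of_forall fun t => ?_)
    rw [Real.norm_eq_abs, abs_le, ← hc]
    have hplus := mul_nonneg hR.le (sq_nonneg (u t + c * h t))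
    have hminus := mul_nonneg hR.le (sq_nonneg (u t - c * h t))
    constructor <;> linarith
  refine ⟨hI, ?_⟩
  have hderiv : ∀ t ∈ Set.Ici (0 : ℝ),
      HasDerivAt (fun y => P * h y ^ 2) (2 * (R * c) * (h t * u t)) t := by
    intro t ht
    refine (((hode t ht).pow 2).const_mul P).congr_deriv ?_
    rw [← hPB]
    push_cast
    ring
  have htend : Filter.Tendsto (fun y => P * h y ^ 2) Filter.atTop (nhds 0) := by
    simpa using (hlim.pow 2).const_mul P
  rw [integral_Ici_eq_integral_Ioi,
    integral_Ioi_of_hasDerivAt_of_tendsto' hderiv (hI.mono_set Set.Ioi_subset_Ici_self) htend,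
    zero_sub]

/-- Scalar infinite-horizon LQR for the integrator `dh/dt = B u`: every admissible pair
`(h, u)` with `h(t) → 0` and integrable cost satisfies
`∫₀^∞ (Q h² + R u²) ≥ P h(0)²` where `P = √(Q R)/|B|`; moreover the linear feedback
`u = − sign(B) √(Q/R) h` yields `h(t) = h(0) e^{−|B| √(Q/R) t}` and achieves the bound
with equality. -/
theorem scalar_lqr_value (B Q R : ℝ) (hB : B ≠ 0) (hQ : 0 < Q) (hR : 0 < R)
    (P : ℝ) (hP : P = Real.sqrt (Q * R) / |B|)
    (h u : ℝ → ℝ) (hu : Continuous u)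
    (hode : ∀ t ≥ (0 : ℝ), HasDerivAt h (B * u t) t)
    (hlim : Filter.Tendsto h Filter.atTop (nhds 0))
    (hint : IntegrableOn (fun t => Q * h t ^ 2 + R * u t ^ 2) (Set.Ici 0)) :
    P * h 0 ^ 2 ≤ ∫ t in Set.Ici (0 : ℝ), (Q * h t ^ 2 + R * u t ^ 2) ∧
      ((∀ t ≥ (0 : ℝ), u t = -Real.sign B * Real.sqrt (Q / R) * h t) →
        (∀ t ≥ (0 : ℝ), h t = h 0 * Real.exp (-(|B| * Real.sqrt (Q / R)) * t)) ∧
        ∫ t in Set.Ici (0 : ℝ), (Q * h t ^ 2 + R * u t ^ 2) = P * h 0 ^ 2) := by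
  set c := Real.sign B * Real.sqrt (Q / R) with hc_def
  have hsign : Real.sign B ^ 2 = 1 := by
    rcases Real.sign_apply_eq_of_ne_zero B hB with hs | hs <;> rw [hs] <;> norm_num
  have hBabs : B = Real.sign B * |B| := by
    rcases hB.lt_or_gt with hlt | hgt
    · rw [Real.sign_of_neg hlt, abs_of_neg hlt]; ring
    · rw [Real.sign_of_pos hgt, abs_of_pos hgt]; ring
  have hc : R * c ^ 2 = Q := by
    rw [hc_def, mul_pow, hsign, Real.sq_sqrt (by positivity)]
    field_simp
  have hsqrt : Real.sqrt (Q * R) = R * Real.sqrt (Q / R) := by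
    rw [show Q * R = R ^ 2 * (Q / R) by field_simp, Real.sqrt_mul (by positivity),
      Real.sqrt_sq hR.le]
  have hBc : B * c = |B| * Real.sqrt (Q / R) := by
    linear_combination Real.sign B * Real.sqrt (Q / R) * hBabs + |B| * Real.sqrt (Q / R) * hsign
  have hPB : P * B = R * c := by
    have hB' : |B| ≠ 0 := abs_ne_zero.mpr hB
    rw [hP, hsqrt, div_mul_eq_mul_div, div_eq_iff hB']
    linear_combination R * Real.sqrt (Q / R) * hBabs
  obtain ⟨hI, hval⟩ := integral_deriv_value hR hc hPB hu hode hlim hint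
  have hneg : ∫ t in Set.Ici (0 : ℝ), -(2 * (R * c) * (h t * u t)) = P * h 0 ^ 2 := by
    rw [integral_neg, hval, neg_neg]
  refine ⟨?_, fun hfb => ⟨fun t ht => ?_, ?_⟩⟩
  · rw [← hneg]
    refine integral_mono hI.neg hint fun t => ?_
    have hsq := mul_nonneg hR.le (sq_nonneg (u t + c * h t))
    simp only [← hc]
    linarith
  · refine eq_mul_exp_of_hasDerivAt (fun s hs => (hode s hs).congr_deriv ?_) ht
    rw [hfb s hs, ← hBc, hc_def]
    ring
  · rw [← hneg]
    refine setIntegral_congr_fun measurableSet_Ici fun t ht => ?_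
    have hut : u t = -c * h t := by rw [hfb t ht, hc_def]; ring
    simp only [hut, ← hc]
    ring
end
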